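/- arXiv:2408.07370 — 2 statements merged into one kernel-verified Lean document; each statement's English description precedes it below -/
import Mathlib

section
/- Let G = (V,E) be a finite simple graph with capacities κ_v ∈ ℕ, let x ∈ ℕ, and for each vertex v define l(v,x) := max{0, δ(v) − min{κ_v, x} + 1}. If there exists a subset K ⊆ V such that the number of edges having at least one endpoint in K is strictly less than Σ_{v ∈ K, l(v,x) > 1} l(v,x), then x*(G) > x. -/
open Finset

/-- An orientation of a simple graph `G`: `dir u v = true` means the edge `{u,v}`
is directed from `u` (tail) to `v` (head), i.e. the edge receives color `u`. -/
structure GraphOrientation {V : Type*} (G : SimpleGraph V) where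
  dir : V → V → Bool
  adj_of_dir : ∀ u v, dir u v = true → G.Adj u v
  dir_iff : ∀ u v, G.Adj u v → (dir u v = true ↔ dir v u = false)

variable {V : Type*} [Fintype V]

/-- The indegree of `v` under an orientation. -/
def GraphOrientation.indeg {G : SimpleGraph V} (Λ : GraphOrientation G) (v : V) : ℕ :=
  (univ.filter fun u => Λ.dir u v = true).card

/-- The outdegree of `v` under an orientation. -/
def GraphOrientation.outdeg {G : SimpleGraph V} (Λ : GraphOrientation G) (v : V) : ℕ :=
  (univ.filter fun u => Λ.dir v u = true).card

/-- The star value `x(G,Λ,v) = δ⁻(v) + (1 if δ⁺(v) > 0 else 0)`. -/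
def GraphOrientation.starVal {G : SimpleGraph V} (Λ : GraphOrientation G) (v : V) : ℕ :=
  Λ.indeg v + (if 0 < Λ.outdeg v then 1 else 0)

/-- `x(G,Λ) = max over vertices of the star value`. -/
def GraphOrientation.starMax {G : SimpleGraph V} (Λ : GraphOrientation G) : ℕ :=
  univ.sup fun v => Λ.starVal v

/-- The min-max star partitioning number `x*(G)` (no capacity constraints). -/
noncomputable def xStar (G : SimpleGraph V) : ℕ :=
  sInf {n | ∃ Λ : GraphOrientation G, Λ.starMax = n}

/-- The min-max star partitioning number `x*(G)` with capacities `κ`: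
an orientation is valid if every star value respects the capacity;
the value is `∞` (i.e. `⊤ : ℕ∞`) if no valid orientation exists. -/
noncomputable def xStarCap (G : SimpleGraph V) (κ : V → ℕ) : ℕ∞ :=
  sInf {n : ℕ∞ | ∃ Λ : GraphOrientation G,
    (∀ v, Λ.starVal v ≤ κ v) ∧ (Λ.starMax : ℕ∞) = n}

/-- `l(v,x) = max {0, δ(v) - min {κ_v, x} + 1}` (the natural subtraction
`δ(v) + 1 - min {κ_v, x}` agrees with the integer formula). -/
def lowerBd (G : SimpleGraph V) [DecidableRel G.Adj] (κ : V → ℕ) (x : ℕ) (v : V) : ℕ :=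
  G.degree v + 1 - min (κ v) x

namespace GraphOrientation

variable {G : SimpleGraph V} (Λ : GraphOrientation G)

omit [Fintype V] in
theorem not_dir_symm {u v : V} (h : Λ.dir u v = true) : Λ.dir v u = false :=
  (Λ.dir_iff u v (Λ.adj_of_dir u v h)).1 h

theorem indeg_add_outdeg [DecidableRel G.Adj] (v : V) :
    Λ.indeg v + Λ.outdeg v = G.degree v := by
  classical
  rw [indeg, outdeg, ← G.card_neighborFinset_eq_degree, ← card_union_of_disjoint]
  · congr 1
    ext u
    simp only [mem_union, mem_filter, mem_univ, true_and, SimpleGraph.mem_neighborFinset]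
    constructor
    · rintro (h | h)
      · exact (Λ.adj_of_dir _ _ h).symm
      · exact Λ.adj_of_dir _ _ h
    · intro h
      have := Λ.dir_iff v u h
      grind
  · rw [disjoint_filter]
    intro u _ h
    simp [Λ.not_dir_symm h]

/-- A vertex with `l(v,x) > 1` has at least `l(v,x)` outgoing edges. -/
theorem lowerBd_le_outdeg [DecidableRel G.Adj] {κ : V → ℕ} {x : ℕ} {v : V}
    (hκ : Λ.starVal v ≤ κ v) (hx : Λ.starVal v ≤ x) (hl : 1 < lowerBd G κ x v) :
    lowerBd G κ x v ≤ Λ.outdeg v := by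
  have hdeg := Λ.indeg_add_outdeg v
  have hmin := le_min hκ hx
  unfold lowerBd at *
  unfold starVal at hmin
  split_ifs at hmin <;> omega

/-- Every edge leaves at most one vertex, so the total outdegree of a vertex set is bounded
by the number of edges incident to it. -/
theorem sum_outdeg_le_card_incident [DecidableEq V] [DecidableRel G.Adj] (K : Finset V) :
    ∑ v ∈ K, Λ.outdeg v ≤ (G.edgeFinset.filter fun e => ∃ v ∈ K, v ∈ e).card := by
  simp only [outdeg]
  rw [← card_sigma]
  refine card_le_card_of_injOn (fun p => s(p.1, p.2)) ?_ ?_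
  · rintro ⟨v, u⟩ h
    simp only [coe_sigma, Set.mem_sigma_iff, mem_coe, mem_filter, mem_univ, true_and] at h
    simp only [mem_coe, mem_filter, SimpleGraph.mem_edgeFinset, SimpleGraph.mem_edgeSet]
    exact ⟨Λ.adj_of_dir _ _ h.2, v, h.1, Sym2.mem_mk_left _ _⟩
  · rintro ⟨v, u⟩ h ⟨v', u'⟩ h' heq
    simp only [coe_sigma, Set.mem_sigma_iff, mem_coe, mem_filter, mem_univ, true_and] at h h'
    rcases Sym2.eq_iff.1 heq with ⟨rfl, rfl⟩ | ⟨rfl, rfl⟩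
    · rfl
    · simp [Λ.not_dir_symm h.2] at h'

end GraphOrientation

/-- If some set `K` of vertices has fewer incident edges than
`Σ_{v ∈ K, l(v,x) > 1} l(v,x)`, then `x*(G) > x`. -/
theorem stmt9 [DecidableEq V] (G : SimpleGraph V) [DecidableRel G.Adj] (κ : V → ℕ) (x : ℕ)
    (K : Finset V)
    (h : (G.edgeFinset.filter fun e => ∃ v ∈ K, v ∈ e).card <
      ∑ v ∈ K.filter (fun v => 1 < lowerBd G κ x v), lowerBd G κ x v) :
    (x : ℕ∞) < xStarCap G κ := by
  refine lt_of_lt_of_le (b := ((x + 1 : ℕ) : ℕ∞)) (by exact_mod_cast x.lt_succ_self) ?_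
  refine le_sInf ?_
  rintro _ ⟨Λ, hκ, rfl⟩
  rw [Nat.cast_le]
  by_contra! hx
  refine h.not_ge ?_
  calc ∑ v ∈ K.filter (fun v => 1 < lowerBd G κ x v), lowerBd G κ x v
      ≤ ∑ v ∈ K.filter (fun v => 1 < lowerBd G κ x v), Λ.outdeg v := by
        refine sum_le_sum fun v hv => Λ.lowerBd_le_outdeg (hκ v) ?_ (mem_filter.1 hv).2
        exact (le_sup (f := fun v => Λ.starVal v) (mem_univ v)).trans (Nat.lt_succ_iff.1 hx)
    _ ≤ ∑ v ∈ K, Λ.outdeg v := sum_le_sum_of_subset (filter_subset _ _)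
    _ ≤ _ := Λ.sum_outdeg_le_card_incident K
end

section
/- Let G = (V,E) be a finite simple graph with nonempty vertex set, vertex weights w_v > 0, and let k > 0 be real. Set M := k + 2·max_{v∈V} w_v. Let G' be the graph obtained from G by attaching, at each vertex v ∈ V, a disjoint copy of the gadget: new vertices v₁, v₂, v₃, v₄ and ṽ, ṽ₁, ṽ₂, ṽ₃, ṽ₄, new edges {v,v₁}, {v₁,v₂}, {v₂,v₃}, {v₂,v₄}, {v₃,v₄}, {v,ṽ}, {v₁,ṽ₁}, {v₂,ṽ₂}, {v₃,ṽ₃}, {v₄,ṽ₄}, and weights w_{v₁} = w_{v₄} = M − w_v, w_{v₂} = w_{v₃} = k + w_v, and M + k + 1 on each of ṽ, ṽ₁, ṽ₂, ṽ₃, ṽ₄. Then there exists an orientation Λ of G with maximum weighted indegree k(G,Λ) ≤ k if and only if there exists an orientation Λ' of G' with weighted star value x(G',Λ') ≤ M + k. -/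
open Finset

variable {V : Type*} [Fintype V]

/-- The weighted indegree `k(G,Λ,v)`: the sum of the weights of the tails of the
edges directed toward `v`. -/
def GraphOrientation.wIndeg {G : SimpleGraph V} (Λ : GraphOrientation G)
    (w : V → ℝ) (v : V) : ℝ :=
  ∑ u ∈ univ.filter (fun u => Λ.dir u v = true), w u

/-- The weighted star value `x(G,Λ,v) = k(G,Λ,v) + (w_v if v has an outgoing edge)`. -/
def GraphOrientation.wStarVal {G : SimpleGraph V} (Λ : GraphOrientation G)
    (w : V → ℝ) (v : V) : ℝ :=
  Λ.wIndeg w v + (if 0 < Λ.outdeg v then w v else 0)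

/-- `k(G,Λ) = max over vertices of the weighted indegree`. -/
noncomputable def GraphOrientation.wIndegMax [Nonempty V] {G : SimpleGraph V}
    (Λ : GraphOrientation G) (w : V → ℝ) : ℝ :=
  univ.sup' univ_nonempty (Λ.wIndeg w)

/-- `x(G,Λ) = max over vertices of the weighted star value`. -/
noncomputable def GraphOrientation.wStarMax [Nonempty V] {G : SimpleGraph V}
    (Λ : GraphOrientation G) (w : V → ℝ) : ℝ :=
  univ.sup' univ_nonempty (Λ.wStarVal w)

/-- The gadget edges among `v = (v,0), v₁ = (v,1), v₂ = (v,2), v₃ = (v,3), v₄ = (v,4)`: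
`{v,v₁}, {v₁,v₂}, {v₂,v₃}, {v₂,v₄}, {v₃,v₄}`. -/
def gadgetPair (i j : Fin 5) : Prop :=
  (i = 0 ∧ j = 1) ∨ (i = 1 ∧ j = 2) ∨ (i = 2 ∧ j = 3) ∨ (i = 2 ∧ j = 4) ∨ (i = 3 ∧ j = 4)

/-- The graph `G'` obtained from `G` by attaching a gadget at each vertex `v`:
the vertex `(v,0)` on the left represents `v` itself, `(v,i)` for `i = 1,…,4`
are the new gadget vertices `v_i`, and the right copy of `(v,i)` is `ṽ_i`
(with `ṽ₀ = ṽ`). The edges are the original edges of `G` (between `(v,0)`'s),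
the five gadget edges at each `v`, and the pendant edges `{v_i, ṽ_i}`. -/
def reductionGraph (G : SimpleGraph V) : SimpleGraph ((V × Fin 5) ⊕ (V × Fin 5)) :=
  SimpleGraph.fromRel (fun a b =>
    match a, b with
    | .inl (v, i), .inl (u, j) => (v = u ∧ gadgetPair i j) ∨ (i = 0 ∧ j = 0 ∧ G.Adj v u)
    | .inl (v, i), .inr (u, j) => v = u ∧ i = j
    | _, _ => False)

/-- The weights on `G'`: `w_v` on `v = (v,0)`, `M - w_v` on `v₁, v₄`,
`k + w_v` on `v₂, v₃`, and `M + k + 1` on each `ṽ_i`. -/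
noncomputable def reductionWeight (w : V → ℝ) (k M : ℝ) :
    (V × Fin 5) ⊕ (V × Fin 5) → ℝ :=
  Sum.elim (fun p => ![w p.1, M - w p.1, k + w p.1, k + w p.1, M - w p.1] p.2)
    (fun _ => M + k + 1)

lemma reductionGraph_adj_inl_inl {U : Type*} {G : SimpleGraph U} {u v : U} {i j : Fin 5} :
    (reductionGraph G).Adj (.inl (u, i)) (.inl (v, j)) ↔
      (u = v ∧ (gadgetPair i j ∨ gadgetPair j i)) ∨ (i = 0 ∧ j = 0 ∧ G.Adj u v) := by
  have hne : gadgetPair i j ∨ gadgetPair j i → i ≠ j := by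
    unfold gadgetPair; revert i j; decide
  have hadj : G.Adj u v → u ≠ v := fun h => h.ne
  simp only [reductionGraph, SimpleGraph.fromRel_adj, ne_eq, Sum.inl.injEq, Prod.mk.injEq,
    G.adj_comm v u]
  grind

lemma reductionGraph_adj_inl_inr {U : Type*} {G : SimpleGraph U} {p q : U × Fin 5} :
    (reductionGraph G).Adj (.inl p) (.inr q) ↔ p = q := by
  simp [reductionGraph, SimpleGraph.fromRel_adj, Prod.ext_iff]

lemma reductionGraph_adj_inr_inl {U : Type*} {G : SimpleGraph U} {p q : U × Fin 5} :
    (reductionGraph G).Adj (.inr p) (.inl q) ↔ p = q := by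
  rw [SimpleGraph.adj_comm, reductionGraph_adj_inl_inr, eq_comm]

lemma not_reductionGraph_adj_inr_inr {U : Type*} {G : SimpleGraph U} {p q : U × Fin 5} :
    ¬ (reductionGraph G).Adj (.inr p) (.inr q) := by
  simp [reductionGraph, SimpleGraph.fromRel_adj]


namespace GraphOrientation

lemma dir_eq_false {W : Type*} {G : SimpleGraph W} (Λ : GraphOrientation G) {u v : W}
    (h : ¬ G.Adj u v) : Λ.dir u v = false := by
  by_contra h'
  exact h (Λ.adj_of_dir u v (by simpa using h'))

lemma dir_eq_not {W : Type*} {G : SimpleGraph W} (Λ : GraphOrientation G) {u v : W}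
    (h : G.Adj u v) : Λ.dir u v = !Λ.dir v u := by
  have := Λ.dir_iff u v h
  grind

lemma outdeg_pos {G : SimpleGraph V} (Λ : GraphOrientation G) {u v : V}
    (h : Λ.dir u v = true) : 0 < Λ.outdeg u :=
  Finset.card_pos.mpr ⟨v, by simpa using h⟩

lemma wIndeg_nonneg {G : SimpleGraph V} (Λ : GraphOrientation G) {w : V → ℝ}
    (hw : ∀ v, 0 ≤ w v) (v : V) : 0 ≤ Λ.wIndeg w v :=
  Finset.sum_nonneg fun u _ => hw u

/-- On `G'`, the weighted indegree of `v_i` splits into the contributions of the gadget at `v`,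
of the copy of `G` (only if `i = 0`), and of the pendant vertex `ṽ_i`. -/
lemma wIndeg_inl {G : SimpleGraph V} (Λ : GraphOrientation (reductionGraph G))
    (W : (V × Fin 5) ⊕ (V × Fin 5) → ℝ) (v : V) (i : Fin 5) :
    Λ.wIndeg W (.inl (v, i)) =
      (∑ j, if Λ.dir (.inl (v, j)) (.inl (v, i)) then W (.inl (v, j)) else 0) +
      (if i = 0 then
        ∑ u, if Λ.dir (.inl (u, 0)) (.inl (v, 0)) then W (.inl (u, 0)) else 0 else 0) +
      (if Λ.dir (.inr (v, i)) (.inl (v, i)) then W (.inr (v, i)) else 0) := by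
  classical
  rw [wIndeg, Finset.sum_filter, Fintype.sum_sum_type]
  congr 1
  · have hsplit : ∀ u j, (if Λ.dir (.inl (u, j)) (.inl (v, i)) then W (.inl (u, j)) else 0) =
        (if u = v then
          (if Λ.dir (.inl (v, j)) (.inl (v, i)) then W (.inl (v, j)) else 0) else 0) +
        (if j = 0 then (if i = 0 then
          (if Λ.dir (.inl (u, 0)) (.inl (v, 0)) then W (.inl (u, 0)) else 0) else 0) else 0) := by
      intro u j
      have hself : Λ.dir (.inl (v, 0)) (.inl (v, 0)) = false :=
        Λ.dir_eq_false (SimpleGraph.irrefl _)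
      have hadj := Λ.adj_of_dir (.inl (u, j)) (.inl (v, i))
      rw [reductionGraph_adj_inl_inl] at hadj
      by_cases huv : u = v
      · subst huv
        by_cases hj : j = 0 <;> by_cases hi : i = 0 <;> simp [hi, hj, hself]
      · by_cases hj : j = 0 <;> by_cases hi : i = 0 <;> simp_all
    rw [Fintype.sum_prod_type]
    rw [Finset.sum_congr rfl fun u _ => Finset.sum_congr rfl fun j _ => hsplit u j]
    simp only [Finset.sum_add_distrib]
    congr 1
    · rw [Finset.sum_comm]
      simp
    · by_cases hi : i = 0 <;> simp [hi]
  · rw [Fintype.sum_eq_single (v, i)]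
    intro p hp
    rw [Λ.dir_eq_false (by rwa [reductionGraph_adj_inr_inl])]
    simp

lemma wIndeg_inr {G : SimpleGraph V} (Λ : GraphOrientation (reductionGraph G))
    (W : (V × Fin 5) ⊕ (V × Fin 5) → ℝ) (p : V × Fin 5) :
    Λ.wIndeg W (.inr p) = if Λ.dir (.inl p) (.inr p) then W (.inl p) else 0 := by
  rw [wIndeg, Finset.sum_filter, Fintype.sum_sum_type, Fintype.sum_eq_single p,
    Finset.sum_eq_zero, add_zero]
  · intro q _
    simp [Λ.dir_eq_false not_reductionGraph_adj_inr_inr]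
  · intro q hq
    simp [Λ.dir_eq_false (mt reductionGraph_adj_inl_inr.mp hq)]

/-- The orientation induced on `G` by an orientation of `G'`. -/
def ofReduction {G : SimpleGraph V} (Λ : GraphOrientation (reductionGraph G)) :
    GraphOrientation G where
  dir u v := Λ.dir (.inl (u, 0)) (.inl (v, 0))
  adj_of_dir u v h := by
    simpa [reductionGraph_adj_inl_inl, gadgetPair] using Λ.adj_of_dir _ _ h
  dir_iff u v h := Λ.dir_iff _ _ (reductionGraph_adj_inl_inl.mpr (.inr ⟨rfl, rfl, h⟩))

/-- The arcs `v₁ → v`, `v₂ → v₁`, `v₂ → v₃`, `v₃ → v₄`, `v₄ → v₂` of an oriented gadget. -/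
def gadgetArc (i j : Fin 5) : Bool :=
  (i, j) ∈ ({(1, 0), (2, 1), (2, 3), (3, 4), (4, 2)} : Finset (Fin 5 × Fin 5))

/-- The orientation of `G'` extending one of `G`: gadgets are oriented by `gadgetArc`, and
pendant edges are directed towards the pendant vertices. -/
noncomputable def toReduction {G : SimpleGraph V} (Λ : GraphOrientation G) :
    GraphOrientation (reductionGraph G) where
  dir a b := open Classical in
    match a, b with
    | .inl (u, i), .inl (v, j) =>
      (decide (u = v) && gadgetArc i j) || (decide (i = 0 ∧ j = 0) && Λ.dir u v)
    | .inl p, .inr q => decide (p = q)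
    | .inr _, _ => false
  adj_of_dir := by
    have harc : ∀ i j, gadgetArc i j = true → gadgetPair i j ∨ gadgetPair j i := by
      unfold gadgetPair; decide
    rintro (⟨u, i⟩ | p) (⟨v, j⟩ | q) h
    · rw [reductionGraph_adj_inl_inl]
      have := harc i j
      have := Λ.adj_of_dir u v
      grind
    · simpa [reductionGraph_adj_inl_inr] using h
    · simp at h
    · simp at h
  dir_iff := by
    have harc : ∀ i j, gadgetPair i j ∨ gadgetPair j i →
        gadgetArc i j = !gadgetArc j i ∧ ¬ (i = 0 ∧ j = 0) := by
      unfold gadgetPair; decide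
    have harc0 : gadgetArc 0 0 = false := by decide
    rintro (⟨u, i⟩ | p) (⟨v, j⟩ | q) h
    · rw [reductionGraph_adj_inl_inl] at h
      rcases h with ⟨rfl, h⟩ | ⟨rfl, rfl, h⟩
      · obtain ⟨h1, h2⟩ := harc i j h
        have h3 : ¬ (j = 0 ∧ i = 0) := fun h => h2 h.symm
        simp [h1, h2, h3]
      · simpa [harc0] using Λ.dir_iff u v h
    · simpa [reductionGraph_adj_inl_inr] using h
    · simpa [reductionGraph_adj_inr_inl, eq_comm] using h
    · exact absurd h not_reductionGraph_adj_inr_inr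

lemma wStarVal_toReduction_le {G : SimpleGraph V} (Λ : GraphOrientation G) {w : V → ℝ}
    {k M : ℝ} (hw : ∀ v, 0 < w v) (hk : 0 < k) (hM : ∀ v, k + 2 * w v ≤ M)
    (hΛ : ∀ v, Λ.wIndeg w v ≤ k) (a : (V × Fin 5) ⊕ (V × Fin 5)) :
    Λ.toReduction.wStarVal (reductionWeight w k M) a ≤ M + k := by
  rcases a with ⟨v, i⟩ | ⟨v, i⟩
  · have hout : 0 < Λ.toReduction.outdeg (.inl (v, i)) :=
      Λ.toReduction.outdeg_pos (v := .inr (v, i)) (by simp [toReduction])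
    have hself : Λ.dir v v = false := Λ.dir_eq_false (SimpleGraph.irrefl _)
    have hdeg := hΛ v
    rw [wIndeg, Finset.sum_filter] at hdeg
    rw [wStarVal, wIndeg_inl, if_pos hout]
    have := hw v
    have := hM v
    fin_cases i <;>
      simp [reductionWeight, toReduction, gadgetArc, hself] <;> linarith
  · have hout : ¬ 0 < Λ.toReduction.outdeg (.inr (v, i)) := by
      simp [outdeg, toReduction]
    rw [wStarVal, wIndeg_inr, if_neg hout]
    have := hw v
    have := hM v
    fin_cases i <;> simp [reductionWeight, toReduction] <;> linarith

lemma wIndeg_ofReduction_le {G : SimpleGraph V} (Λ : GraphOrientation (reductionGraph G))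
    {w : V → ℝ} {k M : ℝ} (hw : ∀ v, 0 < w v) (hk : 0 < k) (hM : ∀ v, k + 2 * w v ≤ M)
    (hΛ : ∀ a, Λ.wStarVal (reductionWeight w k M) a ≤ M + k) (v : V) :
    Λ.ofReduction.wIndeg w v ≤ k := by
  have hW : ∀ a, 0 ≤ reductionWeight w k M a := by
    rintro (⟨u, i⟩ | ⟨u, i⟩) <;> have := hw u <;> have := hM u
    · fin_cases i <;> simp [reductionWeight] <;> linarith
    · simp only [reductionWeight, Sum.elim_inr]
      linarith
  have hin : ∀ p, Λ.dir (.inr p) (.inl p) = false := by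
    intro p
    by_contra h
    have hstar := hΛ (.inr p)
    rw [wStarVal, if_pos (Λ.outdeg_pos (by simpa using h))] at hstar
    have := Λ.wIndeg_nonneg hW (.inr p)
    simp only [reductionWeight, Sum.elim_inr] at hstar this
    linarith
  have hstar : ∀ i, Λ.wIndeg (reductionWeight w k M) (.inl (v, i)) +
      reductionWeight w k M (.inl (v, i)) ≤ M + k := by
    intro i
    have hout : Λ.dir (.inl (v, i)) (.inr (v, i)) = true := by
      rw [Λ.dir_eq_not (reductionGraph_adj_inl_inr.mpr rfl), hin, Bool.not_false]
    simpa [wStarVal, Λ.outdeg_pos hout] using hΛ (.inl (v, i))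
  have hflip : ∀ i j, gadgetPair i j →
      Λ.dir (.inl (v, j)) (.inl (v, i)) = !Λ.dir (.inl (v, i)) (.inl (v, j)) := fun i j h =>
    Λ.dir_eq_not (reductionGraph_adj_inl_inl.mpr (.inl ⟨rfl, .inr h⟩))
  have hnone : ∀ i j, ¬ gadgetPair i j → ¬ gadgetPair j i →
      Λ.dir (.inl (v, i)) (.inl (v, j)) = false := by
    intro i j h1 h2
    refine Λ.dir_eq_false ?_
    rw [reductionGraph_adj_inl_inl]
    simp [h1, h2]
  have f01 := hflip 0 1 (by simp [gadgetPair])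
  have f12 := hflip 1 2 (by simp [gadgetPair])
  have f23 := hflip 2 3 (by simp [gadgetPair])
  have f24 := hflip 2 4 (by simp [gadgetPair])
  have f34 := hflip 3 4 (by simp [gadgetPair])
  have hwv := hw v
  have hMv := hM v
  have h0 := hstar 0
  have h1 := hstar 1
  have h2 := hstar 2
  have h3 := hstar 3
  have h4 := hstar 4
  simp [wIndeg_inl, hin, Fin.sum_univ_five, hnone, gadgetPair, reductionWeight, f01, f12, f23,
    f24, f34] at h0 h1 h2 h3 h4
  have hsum : Λ.ofReduction.wIndeg w v =
      ∑ u, if Λ.dir (.inl (u, 0)) (.inl (v, 0)) then w u else 0 := by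
    rw [wIndeg, Finset.sum_filter]
    rfl
  rw [hsum]
  cases h01 : Λ.dir (.inl (v, 0)) (.inl (v, 1)) <;>
  cases h12 : Λ.dir (.inl (v, 1)) (.inl (v, 2)) <;>
  cases h23 : Λ.dir (.inl (v, 2)) (.inl (v, 3)) <;>
  cases h24 : Λ.dir (.inl (v, 2)) (.inl (v, 4)) <;>
  cases h34 : Λ.dir (.inl (v, 3)) (.inl (v, 4)) <;>
  simp only [h01, h12, h23, h24, h34, if_true, if_false, reduceCtorEq,
    Bool.false_eq_true] at h0 h1 h2 h3 h4 <;>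
  linarith

end GraphOrientation

/-- With `M = k + 2 · max_v w_v`, the graph `G` admits an orientation
with maximum weighted indegree at most `k` iff `G'` admits an orientation with
weighted star value at most `M + k`. -/
theorem stmt15 [Nonempty V] (G : SimpleGraph V) (w : V → ℝ) (hw : ∀ v, 0 < w v)
    (k : ℝ) (hk : 0 < k) (M : ℝ) (hM : M = k + 2 * univ.sup' univ_nonempty w) :
    (∃ Λ : GraphOrientation G, Λ.wIndegMax w ≤ k) ↔
      ∃ Λ' : GraphOrientation (reductionGraph G),
        Λ'.wStarMax (reductionWeight w k M) ≤ M + k := by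
  have hM' : ∀ v, k + 2 * w v ≤ M := fun v => by
    have := Finset.le_sup' w (Finset.mem_univ v)
    linarith
  simp only [GraphOrientation.wIndegMax, GraphOrientation.wStarMax, Finset.sup'_le_iff,
    Finset.mem_univ, true_implies]
  exact ⟨fun ⟨Λ, hΛ⟩ => ⟨Λ.toReduction, Λ.wStarVal_toReduction_le hw hk hM' hΛ⟩,
    fun ⟨Λ, hΛ⟩ => ⟨Λ.ofReduction, Λ.wIndeg_ofReduction_le hw hk hM' hΛ⟩⟩
end
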